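/- arXiv:2311.00632 — 8 statements merged into one kernel-verified Lean document; each statement's English description precedes it below -/
import Mathlib

section
/- Let N ≥ 1 and let J : ℝ^N → [0,∞) be measurable with ∫_{ℝ^N} J(z)·min(|z|²,1) dz < ∞. Then for every t > 0 the function x ↦ e^{−t/J(x)} (interpreted as 0 at points where J(x) = 0) belongs to L¹(ℝ^N). -/
open MeasureTheory Metric

noncomputable section

abbrev Euc (N : ℕ) := EuclideanSpace ℝ (Fin N)

/-- **Exponential integrability of the kernel** (Lemma 2.2): if
`∫ J(z)·min(|z|²,1) dz < ∞`, then for every `t > 0` the function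
`x ↦ e^{-t/J(x)}` (set to `0` where `J` vanishes) is integrable on `ℝ^N`. -/
theorem exp_kernel_integrable
    {N : ℕ} (hN : 1 ≤ N) (J : Euc N → ℝ)
    (hJmeas : Measurable J) (hJnn : ∀ x, 0 ≤ J x)
    (hJint : Integrable (fun z : Euc N => J z * min (‖z‖ ^ 2) 1))
    (t : ℝ) (ht : 0 < t) :
    Integrable (fun x : Euc N => if J x = 0 then 0 else Real.exp (-t / J x)) := by
  have hball : Integrable ((ball (0 : Euc N) 1).indicator fun _ => (1 : ℝ)) :=
    (integrable_indicator_iff measurableSet_ball).2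
      (integrableOn_const measure_ball_lt_top.ne)
  refine (hball.add (hJint.const_mul t⁻¹)).mono' ?_ (Filter.Eventually.of_forall fun x => ?_)
  · exact (Measurable.ite (hJmeas (measurableSet_singleton 0)) measurable_const
      (Real.measurable_exp.comp (measurable_const.div hJmeas))).aestronglyMeasurable
  have hnn : 0 ≤ t⁻¹ * (J x * min (‖x‖ ^ 2) 1) := by
    have := hJnn x
    positivity
  have hind : 0 ≤ (ball (0 : Euc N) 1).indicator (fun _ => (1 : ℝ)) x :=
    Set.indicator_nonneg (fun _ _ => zero_le_one) x
  simp only [Pi.add_apply]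
  split_ifs with hx
  · simpa only [norm_zero] using add_nonneg hind hnn
  have hJpos : 0 < J x := lt_of_le_of_ne (hJnn x) (Ne.symm hx)
  rw [Real.norm_of_nonneg (Real.exp_pos _).le]
  by_cases hxb : x ∈ ball (0 : Euc N) 1
  · rw [Set.indicator_of_mem hxb]
    have : Real.exp (-t / J x) ≤ 1 :=
      Real.exp_le_one_iff.2 (div_nonpos_of_nonpos_of_nonneg (by linarith) hJpos.le)
    linarith
  · have hx1 : 1 ≤ ‖x‖ := by simpa using hxb
    rw [Set.indicator_of_notMem hxb, min_eq_right (one_le_pow₀ hx1), mul_one, zero_add,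
      neg_div, Real.exp_neg]
    calc (Real.exp (t / J x))⁻¹ ≤ (t / J x)⁻¹ := by
          gcongr
          linarith [Real.add_one_le_exp (t / J x)]
      _ = t⁻¹ * J x := by rw [inv_div, div_eq_inv_mul]
end
end

section
/- Let K : ℝ^N × ℝ^N → [0,∞) be measurable with K(x,y) = K(y,x) for all x,y, and let u : ℝ^N → [0,∞) be measurable with ∬_{ℝ^N×ℝ^N} K(x,y)(u(x)−u(y))² dy dx < ∞. Then for every t ≥ 0: (1/2)∬_{ℝ^N×ℝ^N} K(x,y)(u(x)−u(y))·((u(x)−t)⁺ − (u(y)−t)⁺) dy dx = ∫_t^∞ ( ∫_{{u>τ}} ∫_{{u≤τ}} K(x,y)(u(x)−u(y)) dy dx ) dτ, where s⁺ = max(s,0), {u>τ} = {x : u(x) > τ} and {u≤τ} = {x : u(x) ≤ τ}. -/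
open MeasureTheory Metric

open scoped ENNReal

noncomputable section

/-- The layers `τ > t` separating the values `b ≤ τ < a` have total length `(a - max b t)⁺`. -/
lemma integral_Ioi_indicator_Ico_const (t a b c : ℝ) :
    ∫ τ in Set.Ioi t, (Set.Ico b a).indicator (fun _ => c) τ = max (a - max b t) 0 * c := by
  have hset : Set.Ico b a ∩ Set.Ici t = Set.Ico (max b t) a := by
    ext τ
    simp only [Set.mem_inter_iff, Set.mem_Ico, Set.mem_Ici, max_le_iff]
    tauto
  rw [Measure.restrict_congr_set (Ioi_ae_eq_Ici (a := t) (μ := volume)),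
    integral_indicator_const _ measurableSet_Ico, measureReal_restrict_apply measurableSet_Ico,
    hset, Real.volume_real_Ico, smul_eq_mul]

lemma integrable_indicator_Ico_const (μ : Measure ℝ) [IsLocallyFiniteMeasure μ] (a b c : ℝ) :
    Integrable ((Set.Ico b a).indicator fun _ => c) μ :=
  (integrable_indicator_iff measurableSet_Ico).2 (integrableOn_const (measure_Ico_lt_top.ne))

lemma mul_sub_mul_truncation_sub_eq (k a b t : ℝ) :
    k * (a - b) * (max (a - t) 0 - max (b - t) 0) =
      max (a - max b t) 0 * (k * (a - b)) + max (b - max a t) 0 * (k * (b - a)) := by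
  rcases le_total a b with h | h <;> rcases le_total a t with h1 | h1 <;>
    rcases le_total b t with h2 | h2 <;>
    simp only [max_eq_left, max_eq_right, sub_nonneg, sub_nonpos, h, h1, h2] <;>
    first
    | ring1
    | (obtain rfl : a = b := by linarith
       ring1)

lemma abs_max_sub_max_mul_le {k : ℝ} (hk : 0 ≤ k) (a b t : ℝ) :
    |max (a - max b t) 0 * (k * (a - b))| ≤ k * (a - b) ^ 2 := by
  have h1 : max (a - max b t) 0 ≤ |a - b| :=
    max_le ((sub_le_sub_left (le_max_left b t) a).trans (le_abs_self _)) (abs_nonneg _)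
  rw [abs_mul, abs_mul, abs_of_nonneg hk, abs_of_nonneg (le_max_right _ _), ← sq_abs (a - b)]
  calc max (a - max b t) 0 * (k * |a - b|) ≤ |a - b| * (k * |a - b|) := by gcongr
    _ = k * |a - b| ^ 2 := by ring

/-- **Nonlocal coarea formula for truncations** (Proposition 2.8): for a symmetric
nonnegative kernel `K` and a nonnegative measurable `u` with
`∬ K(x,y)(u(x)-u(y))² dy dx < ∞`, for every `t ≥ 0`,
`(1/2)∬ K(x,y)(u(x)-u(y))((u(x)-t)⁺-(u(y)-t)⁺) dy dx
  = ∫_t^∞ ∫_{u>τ} ∫_{u≤τ} K(x,y)(u(x)-u(y)) dy dx dτ`. -/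
theorem nonlocal_coarea_truncation
    {N : ℕ} (hN : 1 ≤ N) (K : Euc N → Euc N → ℝ)
    (hKmeas : Measurable (Function.uncurry K)) (hKnn : ∀ x y, 0 ≤ K x y)
    (hsym : ∀ x y, K x y = K y x)
    (u : Euc N → ℝ) (humeas : Measurable u) (hunn : ∀ x, 0 ≤ u x)
    (hint : Integrable (fun p : Euc N × Euc N => K p.1 p.2 * (u p.1 - u p.2) ^ 2))
    (t : ℝ) (ht : 0 ≤ t) :
    (1 / 2) * (∫ x, ∫ y, K x y * (u x - u y) * (max (u x - t) 0 - max (u y - t) 0)) =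
      ∫ τ in Set.Ioi t,
        ∫ x in {x : Euc N | τ < u x}, ∫ y in {y : Euc N | u y ≤ τ},
          K x y * (u x - u y) := by
  let H : ℝ → Euc N × Euc N → ℝ := fun τ p =>
    (Set.Ico (u p.2) (u p.1)).indicator (fun _ => K p.1 p.2 * (u p.1 - u p.2)) τ
  let G : Euc N × Euc N → ℝ := fun p =>
    max (u p.1 - max (u p.2) t) 0 * (K p.1 p.2 * (u p.1 - u p.2))
  have hu1 : Measurable fun p : Euc N × Euc N => u p.1 := humeas.comp measurable_fst
  have hu2 : Measurable fun p : Euc N × Euc N => u p.2 := humeas.comp measurable_snd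
  have hK : Measurable fun p : Euc N × Euc N => K p.1 p.2 := hKmeas
  have hc : Measurable fun p : Euc N × Euc N => K p.1 p.2 * (u p.1 - u p.2) :=
    hK.mul (hu1.sub hu2)
  have hGmeas : Measurable G :=
    ((hu1.sub (hu2.max measurable_const)).max measurable_const).mul hc
  have hGint : Integrable G :=
    hint.mono' hGmeas.aestronglyMeasurable
      (.of_forall fun p => abs_max_sub_max_mul_le (hKnn _ _) _ _ _)
  have hHmeas : Measurable (Function.uncurry H) := by
    have hS : MeasurableSet {q : ℝ × Euc N × Euc N | u q.2.2 ≤ q.1 ∧ q.1 < u q.2.1} :=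
      (measurableSet_le (hu2.comp measurable_snd) measurable_fst).inter
        (measurableSet_lt measurable_fst (hu1.comp measurable_snd))
    exact (hc.comp measurable_snd).indicator hS
  have hHG (p : Euc N × Euc N) : ∫ τ in Set.Ioi t, H τ p = G p :=
    integral_Ioi_indicator_Ico_const _ _ _ _
  have hHnn (τ : ℝ) (p : Euc N × Euc N) : 0 ≤ H τ p :=
    Set.indicator_nonneg (fun _ h => mul_nonneg (hKnn _ _) (sub_nonneg.2 (h.1.trans h.2.le))) τ
  have hHint : Integrable (Function.uncurry H)
      ((volume.restrict (Set.Ioi t)).prod (volume : Measure (Euc N × Euc N))) := by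
    refine (integrable_prod_iff' hHmeas.aestronglyMeasurable).2
      ⟨.of_forall fun p => integrable_indicator_Ico_const _ (u p.1) (u p.2)
        (K p.1 p.2 * (u p.1 - u p.2)), ?_⟩
    simpa only [Function.uncurry_apply_pair, Real.norm_of_nonneg (hHnn _ _), hHG] using hGint
  have hlayer (τ : ℝ) (x : Euc N) :
      {x : Euc N | τ < u x}.indicator
        (fun x => ∫ y in {y : Euc N | u y ≤ τ}, K x y * (u x - u y)) x = ∫ y, H τ (x, y) := by
    by_cases hx : τ < u x
    · rw [Set.indicator_of_mem (by exact hx),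
        ← integral_indicator (measurableSet_le humeas measurable_const)]
      refine integral_congr_ae (.of_forall fun y => ?_)
      simp [H, Set.indicator, hx]
    · rw [Set.indicator_of_notMem (by exact hx)]
      simp [H, Set.indicator, hx]
  have hright : ∫ τ in Set.Ioi t, ∫ x in {x : Euc N | τ < u x},
      ∫ y in {y : Euc N | u y ≤ τ}, K x y * (u x - u y) = ∫ p, G p := by
    calc _ = ∫ τ in Set.Ioi t, ∫ p, H τ p := by
          refine integral_congr_ae ?_
          filter_upwards [hHint.prod_right_ae] with τ hτ
          rw [← integral_indicator (measurableSet_lt measurable_const humeas)]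
          simp only [hlayer]
          exact (integral_prod _ hτ).symm
      _ = ∫ p, ∫ τ in Set.Ioi t, H τ p := integral_integral_swap hHint
      _ = ∫ p, G p := by simp only [hHG]
  have hleft : ∫ x, ∫ y, K x y * (u x - u y) * (max (u x - t) 0 - max (u y - t) 0) =
      ∫ p, (G p + G p.swap) := by
    refine Eq.trans ?_ (integral_prod _ (hGint.add hGint.swap)).symm
    simp only [G, Pi.add_apply, Function.comp_apply, Prod.fst_swap, Prod.snd_swap,
      mul_sub_mul_truncation_sub_eq]
    simp only [hsym _ _]
  have hsum : ∫ p, (G p + G p.swap) = (∫ p, G p) + ∫ p, G p :=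
    (integral_add hGint hGint.swap).trans (congrArg _ (integral_prod_swap G))
  rw [hleft, hright, hsum]
  ring
end
end

section
/- Let R > 0 and let u, v be nonnegative, radial, Lebesgue-integrable functions on the ball B_R ⊂ ℝ^N (radial means u(x) = ũ(|x|) and v(x) = ṽ(|x|) for some functions ũ, ṽ on [0,R]). Assume there exists r̄ ∈ (0,R] such that ∫_{B_r̄}(u(x)−v(x)) dx > 0 and ∫_{B_r}(u(x)−v(x)) dx ≤ ∫_{B_r̄}(u(x)−v(x)) dx for every r ∈ [0,R]. Let h₁ be a positive, radial, radially nondecreasing function on B_R (h₁(x) = η(|x|) with η positive and nondecreasing) such that (u−v)h₁ is integrable on B_r̄. Then ∫_{B_r̄}(u(x)−v(x))h₁(x) dx > 0. -/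
open MeasureTheory Metric

noncomputable section

/-- If every superlevel set of a measurable `h` with values in `[c, T]` carries nonnegative
`w`-mass, then `c * ∫ w ≤ ∫ w * h`. -/
theorem mul_integral_le_integral_mul_of_superlevel {α : Type*} [MeasurableSpace α]
    {μ : Measure α} [SFinite μ] {w h : α → ℝ} {c T : ℝ} (hw : Integrable w μ)
    (hh : Measurable h) (hc : ∀ x, c ≤ h x) (hT : ∀ x, h x ≤ T)
    (hnn : ∀ t, 0 ≤ ∫ x in {x | t < h x}, w x ∂μ) :
    c * ∫ x, w x ∂μ ≤ ∫ x, w x * h x ∂μ := by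
  have hwh : Integrable (fun x => w x * h x) μ := by
    refine hw.mul_bdd (c := max |c| |T|) hh.aestronglyMeasurable (.of_forall fun x => ?_)
    rw [Real.norm_eq_abs]
    exact abs_le_max_abs_abs (hc x) (hT x)
  have hS : MeasurableSet {p : α × ℝ | p.2 < h p.1} :=
    measurableSet_lt measurable_snd (hh.comp measurable_fst)
  have hF : Integrable (Set.indicator {p : α × ℝ | p.2 < h p.1} fun p => w p.1)
      (μ.prod (volume.restrict (Set.Ioc c T))) :=
    (hw.comp_fst (volume.restrict (Set.Ioc c T))).indicator hS
  have hlayer : ∀ x, ∫ t in Set.Ioc c T,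
      Set.indicator {p : α × ℝ | p.2 < h p.1} (fun p => w p.1) (x, t) = w x * (h x - c) := by
    intro x
    have : (fun t => Set.indicator {p : α × ℝ | p.2 < h p.1} (fun p => w p.1) (x, t))
        = Set.indicator (Set.Iio (h x)) fun _ => w x := by
      ext t
      simp [Set.indicator_apply]
    rw [this, setIntegral_indicator measurableSet_Iio]
    have hI : Set.Ioc c T ∩ Set.Iio (h x) = Set.Ioo c (h x) := by
      ext t
      simp only [Set.mem_inter_iff, Set.mem_Ioc, Set.mem_Iio, Set.mem_Ioo]
      have := hT x
      grind
    rw [hI, setIntegral_const, Real.volume_real_Ioo_of_le (hc x), smul_eq_mul, mul_comm]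
  have hswap := integral_integral_swap
    (f := fun x t => Set.indicator {p : α × ℝ | p.2 < h p.1} (fun p => w p.1) (x, t)) hF
  simp only [hlayer] at hswap
  have hge : 0 ≤ ∫ x, w x * (h x - c) ∂μ := by
    rw [hswap]
    refine integral_nonneg fun t => ?_
    have : (fun x => Set.indicator {p : α × ℝ | p.2 < h p.1} (fun p => w p.1) (x, t))
        = Set.indicator {x | t < h x} w := by
      ext x
      simp [Set.indicator_apply]
    simp only [this, Pi.zero_apply]
    rw [integral_indicator (measurableSet_lt measurable_const hh)]
    exact hnn t
  simp only [mul_sub] at hge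
  rw [integral_sub hwh (hw.mul_const c), integral_mul_const] at hge
  linarith

/-- A sublevel set of a monotone function of the norm inside a ball is, up to a null set,
a concentric ball. -/
theorem exists_ball_ae_eq_sublevel {E : Type*} [NormedAddCommGroup E] [NormedSpace ℝ E]
    [MeasurableSpace E] [BorelSpace E] [FiniteDimensional ℝ E] [Nontrivial E]
    (μ : Measure E) [μ.IsAddHaarMeasure] {g : ℝ → ℝ} (hg : Monotone g) {ρ : ℝ} (hρ : 0 ≤ ρ)
    (t : ℝ) :
    ∃ r ∈ Set.Icc (0 : ℝ) ρ, (ball (0 : E) ρ ∩ {x | g ‖x‖ ≤ t} : Set E) =ᵐ[μ] ball (0 : E) r := by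
  set S := {s | s ∈ Set.Icc (0 : ℝ) ρ ∧ g s ≤ t}
  have hbdd : BddAbove S := ⟨ρ, fun s hs => hs.1.2⟩
  have hle : sSup S ≤ ρ := Real.sSup_le (fun s hs => hs.1.2) hρ
  refine ⟨sSup S, ⟨Real.sSup_nonneg fun s hs => hs.1.1, hle⟩, ?_⟩
  have hnull : ∀ᵐ x ∂μ, x ∉ sphere (0 : E) (sSup S) :=
    measure_eq_zero_iff_ae_notMem.mp (Measure.addHaar_sphere μ 0 (sSup S))
  filter_upwards [hnull] with x hx
  rw [mem_sphere_zero_iff_norm] at hx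
  refine propext ⟨fun h => ?_, fun h => ?_⟩
  · have h1 : ‖x‖ < ρ := mem_ball_zero_iff.mp h.1
    have h2 : ‖x‖ ≤ sSup S := le_csSup hbdd ⟨⟨norm_nonneg x, h1.le⟩, h.2⟩
    exact mem_ball_zero_iff.mpr (lt_of_le_of_ne h2 hx)
  · have h1 : ‖x‖ < sSup S := mem_ball_zero_iff.mp h
    have hne : S.Nonempty := by
      by_contra! hemp
      rw [hemp, Real.sSup_empty] at h1
      exact absurd h1 (norm_nonneg x).not_gt
    obtain ⟨s, hs, hxs⟩ := exists_lt_of_lt_csSup hne h1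
    exact ⟨mem_ball_zero_iff.mpr (h1.trans_le hle), (hg hxs.le).trans hs.2⟩

/-- **Maximum principle for concentrations** (Proposition 2.9, first part): if the
function `r ↦ ∫_{B_r}(u-v)` attains a positive maximum at `rbar ∈ (0,R]`, and `h₁` is
a positive, radially nondecreasing function with `(u-v)h₁` integrable on `B_rbar`,
then `∫_{B_rbar}(u-v)h₁ > 0`. -/
theorem max_principle_concentration
    {N : ℕ} (hN : 1 ≤ N) (R : ℝ) (hR : 0 < R)
    (u v h₁ : Euc N → ℝ) (ut vt η : ℝ → ℝ)
    (hunn : ∀ x ∈ ball (0 : Euc N) R, 0 ≤ u x)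
    (hvnn : ∀ x ∈ ball (0 : Euc N) R, 0 ≤ v x)
    (hurad : ∀ x ∈ ball (0 : Euc N) R, u x = ut ‖x‖)
    (hvrad : ∀ x ∈ ball (0 : Euc N) R, v x = vt ‖x‖)
    (huint : IntegrableOn u (ball (0 : Euc N) R))
    (hvint : IntegrableOn v (ball (0 : Euc N) R))
    (rbar : ℝ) (hrbar : rbar ∈ Set.Ioc 0 R)
    (hpos : 0 < ∫ x in ball (0 : Euc N) rbar, (u x - v x))
    (hmax : ∀ r ∈ Set.Icc (0 : ℝ) R,
      (∫ x in ball (0 : Euc N) r, (u x - v x)) ≤ ∫ x in ball (0 : Euc N) rbar, (u x - v x))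
    (hh₁rad : ∀ x ∈ ball (0 : Euc N) R, h₁ x = η ‖x‖)
    (hηpos : ∀ s ∈ Set.Icc (0 : ℝ) R, 0 < η s)
    (hηmono : MonotoneOn η (Set.Icc (0 : ℝ) R))
    (hint : IntegrableOn (fun x => (u x - v x) * h₁ x) (ball (0 : Euc N) rbar)) :
    0 < ∫ x in ball (0 : Euc N) rbar, (u x - v x) * h₁ x := by
  obtain ⟨hr0, hrR⟩ := hrbar
  have : Nonempty (Fin N) := ⟨⟨0, hN⟩⟩
  have hsub : ball (0 : Euc N) rbar ⊆ ball 0 R := ball_subset_ball hrR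
  have hw : IntegrableOn (fun x => u x - v x) (ball (0 : Euc N) rbar) :=
    (huint.sub hvint).mono_set hsub
  have hmem : ∀ s, max 0 (min s rbar) ∈ Set.Icc (0 : ℝ) R := fun s =>
    ⟨le_max_left _ _, max_le hR.le ((min_le_right _ _).trans hrR)⟩
  set g : ℝ → ℝ := fun s => η (max 0 (min s rbar))
  have hg : Monotone g := fun a b hab =>
    hηmono (hmem a) (hmem b) (max_le_max le_rfl (min_le_min hab le_rfl))
  have hgmeas : Measurable fun x : Euc N => g ‖x‖ := hg.measurable.comp measurable_norm
  have hkey : η 0 * ∫ x in ball (0 : Euc N) rbar, (u x - v x)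
      ≤ ∫ x in ball (0 : Euc N) rbar, (u x - v x) * g ‖x‖ := by
    refine mul_integral_le_integral_mul_of_superlevel (T := η rbar) hw hgmeas
      (fun x => hηmono ⟨le_rfl, hR.le⟩ (hmem _) (le_max_left _ _))
      (fun x => hηmono (hmem _) ⟨hr0.le, hrR⟩ (max_le hr0.le (min_le_right _ _))) fun t => ?_
    obtain ⟨r, hr, hae⟩ := exists_ball_ae_eq_sublevel (volume : Measure (Euc N)) hg hr0.le t
    have hmeas : MeasurableSet {x : Euc N | t < g ‖x‖} := measurableSet_lt measurable_const hgmeas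
    have hsplit := integral_add_compl hmeas hw
    have hcompl : {x : Euc N | t < g ‖x‖}ᶜ = {x | g ‖x‖ ≤ t} := by
      ext x
      simp
    rw [Measure.restrict_restrict hmeas.compl, hcompl, Set.inter_comm _ (ball _ _),
      setIntegral_congr_set hae] at hsplit
    linarith [hmax r ⟨hr.1, hr.2.trans hrR⟩]
  have hgh : ∫ x in ball (0 : Euc N) rbar, (u x - v x) * h₁ x
      = ∫ x in ball (0 : Euc N) rbar, (u x - v x) * g ‖x‖ := by
    refine setIntegral_congr_fun measurableSet_ball fun x hx => ?_
    have hx' : ‖x‖ < rbar := mem_ball_zero_iff.mp hx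
    simp only [g, hh₁rad x (hsub hx), min_eq_left hx'.le, max_eq_right (norm_nonneg x)]
  rw [hgh]
  exact (mul_pos (hηpos 0 ⟨le_rfl, hR.le⟩) hpos).trans_le hkey
end
end

section
/- Let R > 0 and let u, v be nonnegative, radial, Lebesgue-integrable functions on the ball B_R ⊂ ℝ^N (radial means u(x) = ũ(|x|) and v(x) = ṽ(|x|) for some functions ũ, ṽ on [0,R]). Assume there exists r̄ ∈ (0,R) such that ∫_{B_R∖B_r̄}(u(x)−v(x)) dx < 0 and ∫_{B_R∖B_r̄}(u(x)−v(x)) dx ≤ ∫_{B_R∖B_r}(u(x)−v(x)) dx for every r ∈ [0,R]. Let h₂ be a positive, radial, radially nonincreasing function on B_R (h₂(x) = η(|x|) with η positive and nonincreasing) such that (u−v)h₂ is integrable on B_R∖B_r̄. Then ∫_{B_R∖B_r̄}(u(x)−v(x))h₂(x) dx < 0. -/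
open MeasureTheory Metric

noncomputable section

/-- If the integral of `f` over every superlevel set of a bounded nonnegative `g` is nonpositive,
then so is the integral of `f * g` (layer-cake decomposition of `g`). -/
theorem integral_mul_nonpos_of_setIntegral_superlevel_nonpos {α : Type*} [MeasurableSpace α]
    {μ : Measure α} [SFinite μ] {f g : α → ℝ} {M : ℝ} (hf : Integrable f μ) (hg : Measurable g)
    (hg0 : ∀ᵐ x ∂μ, 0 ≤ g x) (hgM : ∀ᵐ x ∂μ, g x ≤ M)
    (hle : ∀ t, ∫ x in {x | t < g x}, f x ∂μ ≤ 0) :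
    ∫ x, f x * g x ∂μ ≤ 0 := by
  set ν : Measure ℝ := volume.restrict (Set.Ioo 0 M)
  have hS : MeasurableSet {p : α × ℝ | p.2 < g p.1} :=
    measurableSet_lt measurable_snd (hg.comp measurable_fst)
  have hF : Integrable ({p : α × ℝ | p.2 < g p.1}.indicator fun p => f p.1) (μ.prod ν) :=
    (hf.comp_fst ν).indicator hS
  have hlayer : ∀ᵐ x ∂μ,
      ∫ t, {p : α × ℝ | p.2 < g p.1}.indicator (fun p => f p.1) (x, t) ∂ν = f x * g x := by
    filter_upwards [hg0, hgM] with x h0 hM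
    have : (fun t => {p : α × ℝ | p.2 < g p.1}.indicator (fun p => f p.1) (x, t)) =
        (Set.Iio (g x)).indicator fun _ => f x := by
      ext t
      simp [Set.indicator]
    rw [this, integral_indicator measurableSet_Iio, Measure.restrict_restrict measurableSet_Iio]
    have hset : Set.Iio (g x) ∩ Set.Ioo 0 M = Set.Ioo 0 (g x) := by
      ext t
      simp only [Set.mem_inter_iff, Set.mem_Iio, Set.mem_Ioo]
      constructor
      · rintro ⟨h1, h2, -⟩
        exact ⟨h2, h1⟩
      · rintro ⟨h1, h2⟩
        exact ⟨h2, h1, h2.trans_le hM⟩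
    rw [hset, setIntegral_const, Real.volume_real_Ioo_of_le h0, smul_eq_mul]
    ring
  rw [← integral_congr_ae hlayer,
    integral_integral_swap
      (f := fun x t => {p : α × ℝ | p.2 < g p.1}.indicator (fun p => f p.1) (x, t)) hF]
  refine integral_nonpos fun t => ?_
  have : (fun x => {p : α × ℝ | p.2 < g p.1}.indicator (fun p => f p.1) (x, t)) =
      {x | t < g x}.indicator f := by
    ext x
    simp [Set.indicator]
  simp only [this, Pi.zero_apply]
  rw [integral_indicator (measurableSet_lt measurable_const hg)]
  exact hle t

/-- If the integrals of `f` over all annuli `a ≤ ‖x‖ < r` with `r ∈ [a, R]` are nonpositive, then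
so is its integral over every superlevel set of an antitone radial function in the annulus
`a ≤ ‖x‖ < R`. -/
theorem setIntegral_radial_superlevel_nonpos {E : Type*} [NormedAddCommGroup E]
    [NormedSpace ℝ E] [MeasurableSpace E] [BorelSpace E] [FiniteDimensional ℝ E]
    (μ : Measure E) [μ.IsAddHaarMeasure] {f : E → ℝ} {g : ℝ → ℝ} {a R : ℝ} (ha : 0 < a)
    (hg : Antitone g)
    (hle : ∀ r ∈ Set.Icc a R, ∫ x in ball (0 : E) r \ ball 0 a, f x ∂μ ≤ 0) (t : ℝ) :
    ∫ x in {x | t < g ‖x‖} ∩ (ball (0 : E) R \ ball 0 a), f x ∂μ ≤ 0 := by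
  set S : Set ℝ := {s | s ∈ Set.Icc a R ∧ t < g s}
  rcases S.eq_empty_or_nonempty with hS | ⟨s₀, hs₀⟩
  · have : {x | t < g ‖x‖} ∩ (ball (0 : E) R \ ball 0 a) = ∅ := by
      refine Set.eq_empty_of_forall_notMem fun x hx => ?_
      simp only [Set.mem_inter_iff, Set.mem_ofPred_eq, Set.mem_sdiff, mem_ball_zero_iff,
        not_lt] at hx
      exact hS.subset (show ‖x‖ ∈ S from ⟨⟨hx.2.2, hx.2.1.le⟩, hx.1⟩)
    simp [this]
  · have hbdd : BddAbove S := ⟨R, fun s hs => hs.1.2⟩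
    have haρ : a ≤ sSup S := hs₀.1.1.trans (le_csSup hbdd hs₀)
    have hρR : sSup S ≤ R := csSup_le ⟨s₀, hs₀⟩ fun s hs => hs.1.2
    refine le_of_eq_of_le (setIntegral_congr_set (Filter.eventuallyEq_set.mpr ?_)) (hle (sSup S) ⟨haρ, hρR⟩)
    have hsphere : ∀ᵐ x ∂μ, x ∉ sphere (0 : E) (sSup S) :=
      measure_eq_zero_iff_ae_notMem.mp
        (Measure.addHaar_sphere_of_ne_zero μ 0 (ha.trans_le haρ).ne')
    filter_upwards [hsphere] with x hx
    simp only [mem_sphere_zero_iff_norm] at hx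
    simp only [Set.mem_inter_iff, Set.mem_ofPred_eq, Set.mem_sdiff, mem_ball_zero_iff, not_lt]
    constructor
    · rintro ⟨h1, h2, h3⟩
      exact ⟨lt_of_le_of_ne (le_csSup hbdd ⟨⟨h3, h2.le⟩, h1⟩) hx, h3⟩
    · rintro ⟨h1, h3⟩
      obtain ⟨s, hs, hxs⟩ := exists_lt_of_lt_csSup ⟨s₀, hs₀⟩ h1
      exact ⟨hs.2.trans_le (hg hxs.le), h1.trans_le hρR, h3⟩

/-- **Minimum principle for concentrations** (Proposition 2.9, second part): if the
function `r ↦ ∫_{B_R∖B_r}(u-v)` attains a negative minimum at `rbar ∈ (0,R)`, and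
`h₂` is a positive, radially nonincreasing function with `(u-v)h₂` integrable on
`B_R∖B_rbar`, then `∫_{B_R∖B_rbar}(u-v)h₂ < 0`. -/
theorem min_principle_concentration
    {N : ℕ} (hN : 1 ≤ N) (R : ℝ) (hR : 0 < R)
    (u v h₂ : Euc N → ℝ) (ut vt η : ℝ → ℝ)
    (hunn : ∀ x ∈ ball (0 : Euc N) R, 0 ≤ u x)
    (hvnn : ∀ x ∈ ball (0 : Euc N) R, 0 ≤ v x)
    (hurad : ∀ x ∈ ball (0 : Euc N) R, u x = ut ‖x‖)
    (hvrad : ∀ x ∈ ball (0 : Euc N) R, v x = vt ‖x‖)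
    (huint : IntegrableOn u (ball (0 : Euc N) R))
    (hvint : IntegrableOn v (ball (0 : Euc N) R))
    (rbar : ℝ) (hrbar : rbar ∈ Set.Ioo 0 R)
    (hneg : (∫ x in ball (0 : Euc N) R \ ball (0 : Euc N) rbar, (u x - v x)) < 0)
    (hmin : ∀ r ∈ Set.Icc (0 : ℝ) R,
      (∫ x in ball (0 : Euc N) R \ ball (0 : Euc N) rbar, (u x - v x)) ≤
        ∫ x in ball (0 : Euc N) R \ ball (0 : Euc N) r, (u x - v x))
    (hh₂rad : ∀ x ∈ ball (0 : Euc N) R, h₂ x = η ‖x‖)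
    (hηpos : ∀ s ∈ Set.Icc (0 : ℝ) R, 0 < η s)
    (hηanti : AntitoneOn η (Set.Icc (0 : ℝ) R))
    (hint : IntegrableOn (fun x => (u x - v x) * h₂ x)
      (ball (0 : Euc N) R \ ball (0 : Euc N) rbar)) :
    (∫ x in ball (0 : Euc N) R \ ball (0 : Euc N) rbar, (u x - v x) * h₂ x) < 0 := by
  obtain ⟨ha, haR⟩ := hrbar
  set A : Set (Euc N) := ball 0 R \ ball 0 rbar
  have hA : MeasurableSet A := measurableSet_ball.diff measurableSet_ball
  have hf : IntegrableOn (fun x => u x - v x) (ball (0 : Euc N) R) := huint.sub hvint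
  have hfA : IntegrableOn (fun x => u x - v x) A := hf.mono_set Set.sdiff_subset
  have hannulus : ∀ r ∈ Set.Icc rbar R,
      ∫ x in ball (0 : Euc N) r \ ball 0 rbar, (u x - v x) ≤ 0 := by
    intro r hr
    have hsplit : A = (ball (0 : Euc N) r \ ball 0 rbar) ∪ (ball 0 R \ ball 0 r) := by
      rw [Set.union_comm]
      exact (Set.sdiff_union_sdiff_cancel (ball_subset_ball hr.2) (ball_subset_ball hr.1)).symm
    have hdisj : Disjoint (ball (0 : Euc N) r \ ball 0 rbar) (ball 0 R \ ball 0 r) :=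
      Set.disjoint_sdiff_right.mono_left Set.sdiff_subset
    have hsum := setIntegral_union hdisj (measurableSet_ball.diff measurableSet_ball)
      (hf.mono_set (Set.sdiff_subset.trans (ball_subset_ball hr.2))) (hf.mono_set Set.sdiff_subset)
    rw [← hsplit] at hsum
    linarith [hmin r ⟨ha.le.trans hr.1, hr.2⟩]
  set ηe : ℝ → ℝ := Set.IccExtend hR.le (fun s => η s)
  have hηe : Antitone ηe := fun s t hst =>
    hηanti (Subtype.coe_prop _) (Subtype.coe_prop _) (Set.monotone_projIcc hR.le hst)
  have hηe_eq : ∀ s ∈ Set.Icc 0 R, ηe s = η s := fun s hs =>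
    Set.IccExtend_of_mem hR.le (fun s : Set.Icc 0 R => η s) hs
  have hR_mem : R ∈ Set.Icc 0 R := ⟨hR.le, le_rfl⟩
  set g : ℝ → ℝ := fun s => ηe s - η R
  have hg : Antitone g := fun s t hst => sub_le_sub_right (hηe hst) _
  have hgm : Measurable fun x : Euc N => g ‖x‖ := hg.measurable.comp measurable_norm
  have hnorm : ∀ x ∈ A, rbar ≤ ‖x‖ ∧ ‖x‖ < R := fun x hx => by
    simpa [A, and_comm] using hx
  have hg0 : ∀ᵐ x ∂volume.restrict A, 0 ≤ g ‖x‖ := by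
    filter_upwards [ae_restrict_mem hA] with x hx
    have := hηe (hnorm x hx).2.le
    rw [hηe_eq R hR_mem] at this
    exact sub_nonneg.mpr this
  have hgM : ∀ᵐ x ∂volume.restrict A, g ‖x‖ ≤ g rbar := by
    filter_upwards [ae_restrict_mem hA] with x hx
    exact hg (hnorm x hx).1
  have hexcess : ∫ x in A, (u x - v x) * g ‖x‖ ≤ 0 := by
    refine integral_mul_nonpos_of_setIntegral_superlevel_nonpos hfA hgm hg0 hgM fun t => ?_
    rw [Measure.restrict_restrict (measurableSet_lt measurable_const hgm)]
    exact setIntegral_radial_superlevel_nonpos volume ha hg hannulus t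
  have hdecomp : Set.EqOn (fun x => (u x - v x) * g ‖x‖)
      (fun x => (u x - v x) * h₂ x - (u x - v x) * η R) A := fun x hx => by
    simp only [g, hh₂rad x hx.1, hηe_eq ‖x‖ ⟨norm_nonneg x, (hnorm x hx).2.le⟩]
    ring
  rw [setIntegral_congr_fun hA hdecomp, integral_sub hint (hfA.mul_const _),
    integral_mul_const] at hexcess
  linarith [mul_neg_of_neg_of_pos hneg (hηpos R hR_mem)]
end
end

section
/- Let N ≥ 2, fix r > 0 and 0 < ρ < ρ' with ρ' − ρ ≤ 2r. Then r² + ρρ' is the maximum of |y|² over the closure of B_r(ρe₁) ∖ B_r(ρ'e₁), and r² + ρρ' is also the minimum of |y|² over the closure of B_r(ρ'e₁) ∖ B_r(ρe₁); in particular both optimum values are attained and are equal. -/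
open Metric

noncomputable section

open scoped RealInnerProductSpace
open Filter Topology

theorem closure_ball_diff_ball_subset {X : Type*} [PseudoMetricSpace X] (a b : X) (r : ℝ) :
    closure (ball a r \ ball b r) ⊆ closedBall a r \ ball b r :=
  closure_minimal (Set.sdiff_subset_sdiff_left ball_subset_closedBall)
    (isClosed_closedBall.sdiff isOpen_ball)

section InnerProduct

variable {E : Type*} [NormedAddCommGroup E] [InnerProductSpace ℝ E]

/-- A point on both of two distinct spheres of the same radius is a limit of points lying in the
first ball but not in the second one. -/
theorem mem_closure_ball_diff_ball {a b p : E} {r : ℝ} (hab : a ≠ b)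
    (ha : ‖p - a‖ = r) (hb : ‖p - b‖ = r) : p ∈ closure (ball a r \ ball b r) := by
  have hr : 0 ≤ r := ha ▸ norm_nonneg _
  have hd : 0 < ‖a - b‖ ^ 2 := by
    have := norm_pos_iff.2 (sub_ne_zero.2 hab)
    positivity
  have hpb : ‖p - b‖ ^ 2 = ‖p - a‖ ^ 2 + 2 * ⟪p - a, a - b⟫ + ‖a - b‖ ^ 2 := by
    rw [← norm_add_sq_real, sub_add_sub_cancel]
  have hpa : ‖p - a‖ ^ 2 = ‖p - b‖ ^ 2 - 2 * ⟪p - b, a - b⟫ + ‖a - b‖ ^ 2 := by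
    rw [← norm_sub_sq_real, sub_sub_sub_cancel_right]
  rw [ha, hb] at hpa hpb
  have hlim : Tendsto (fun s : ℝ => p + s • (a - b)) (𝓝[>] 0) (𝓝 p) := by
    have hc : Continuous fun s : ℝ => p + s • (a - b) := by fun_prop
    simpa using (hc.tendsto 0).mono_left nhdsWithin_le_nhds
  refine mem_closure_of_tendsto hlim ?_
  filter_upwards [Ioo_mem_nhdsGT (zero_lt_one' ℝ)] with s hs
  have expand (c : E) : ‖p + s • (a - b) - c‖ ^ 2
      = ‖p - c‖ ^ 2 + 2 * (s * ⟪p - c, a - b⟫) + s ^ 2 * ‖a - b‖ ^ 2 := by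
    rw [add_sub_right_comm, norm_add_sq_real, real_inner_smul_right, norm_smul, mul_pow,
      Real.norm_eq_abs, sq_abs]
  have hsd := mul_pos hs.1 hd
  constructor
  · rw [mem_ball_iff_norm]
    refine lt_of_pow_lt_pow_left₀ 2 hr ?_
    rw [expand, ha]
    nlinarith [mul_pos hsd (sub_pos.2 hs.2)]
  · rw [mem_ball_iff_norm, not_lt]
    refine le_of_pow_le_pow_left₀ two_ne_zero (norm_nonneg _) ?_
    rw [expand, hb]
    nlinarith [mul_pos hs.1 hsd]

theorem norm_sub_smul_sq {e : E} (he : ‖e‖ = 1) (y : E) (c : ℝ) :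
    ‖y - c • e‖ ^ 2 = ‖y‖ ^ 2 - 2 * (c * ⟪y, e⟫) + c ^ 2 := by
  rw [norm_sub_sq_real, real_inner_smul_right, norm_smul, he, mul_one, Real.norm_eq_abs, sq_abs]

theorem sq_bounds_of_mem_closure_ball_diff_ball {e y : E} (he : ‖e‖ = 1) {r c d : ℝ} (hr : 0 ≤ r)
    (hy : y ∈ closure (ball (c • e) r \ ball (d • e) r)) :
    ‖y‖ ^ 2 - 2 * (c * ⟪y, e⟫) + c ^ 2 ≤ r ^ 2 ∧
      r ^ 2 ≤ ‖y‖ ^ 2 - 2 * (d * ⟪y, e⟫) + d ^ 2 := by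
  obtain ⟨hc, hd⟩ := closure_ball_diff_ball_subset _ _ _ hy
  rw [mem_closedBall_iff_norm] at hc
  rw [mem_ball_iff_norm, not_lt] at hd
  rw [← norm_sub_smul_sq he, ← norm_sub_smul_sq he]
  exact ⟨pow_le_pow_left₀ (norm_nonneg _) hc 2, pow_le_pow_left₀ hr hd 2⟩

/-- Two spheres of radius `r` whose centers lie on the line spanned by `e`, at distance at most
`2 * r`, meet at a point whose squared norm is `r ^ 2 + c * d`. -/
theorem exists_norm_sub_smul_eq {e f : E} (he : ‖e‖ = 1) (hf : ‖f‖ = 1) (hfe : ⟪f, e⟫ = 0)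
    {r c d : ℝ} (hr : 0 ≤ r) (hcd : |d - c| ≤ 2 * r) :
    ∃ p : E, ‖p - c • e‖ = r ∧ ‖p - d • e‖ = r ∧ ‖p‖ ^ 2 = r ^ 2 + c * d := by
  have hh : 0 ≤ r ^ 2 - (d - c) ^ 2 / 4 := by
    have := sq_le_sq' (abs_le.1 hcd).1 (abs_le.1 hcd).2
    linarith
  set h := √(r ^ 2 - (d - c) ^ 2 / 4)
  have hsq : h ^ 2 = r ^ 2 - (d - c) ^ 2 / 4 := Real.sq_sqrt hh
  set p := h • f + ((c + d) / 2) • e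
  have hinner : ⟪p, e⟫ = (c + d) / 2 := by
    simp [p, inner_add_left, real_inner_smul_left, hfe, he]
  have hp : ‖p‖ ^ 2 = r ^ 2 + c * d := by
    simp only [p]
    rw [norm_add_sq_real, real_inner_smul_left, real_inner_smul_right, hfe, norm_smul, norm_smul,
      he, hf, mul_one, mul_one, Real.norm_eq_abs, Real.norm_eq_abs, sq_abs, sq_abs, hsq]
    ring
  refine ⟨p, ?_, ?_, hp⟩ <;>
  · rw [← sq_eq_sq₀ (norm_nonneg _) hr, norm_sub_smul_sq he, hinner, hp]
    ring

end InnerProduct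

/-- **Geometric lemma on symmetric differences of shifted balls** (Lemma 2.10,
equality \eqref{eq_monotonicity}): for `N ≥ 2`, `0 < ρ < ρ'` with `ρ' - ρ ≤ 2r`,
the value `r² + ρρ'` is the maximum of `|y|²` over the closure of
`B_r(ρe₁) ∖ B_r(ρ'e₁)` and the minimum of `|y|²` over the closure of
`B_r(ρ'e₁) ∖ B_r(ρe₁)`. -/
theorem shifted_balls_dist_max_min
    {N : ℕ} (hN : 2 ≤ N) (r ρ ρ' : ℝ) (hr : 0 < r) (hρ : 0 < ρ) (hlt : ρ < ρ')
    (hclose : ρ' - ρ ≤ 2 * r) :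
    IsGreatest ((fun y : Euc N => ‖y‖ ^ 2) '' closure
        (ball (ρ • (EuclideanSpace.single (⟨0, by omega⟩ : Fin N) (1 : ℝ))) r \
          ball (ρ' • (EuclideanSpace.single (⟨0, by omega⟩ : Fin N) (1 : ℝ))) r))
      (r ^ 2 + ρ * ρ') ∧
    IsLeast ((fun y : Euc N => ‖y‖ ^ 2) '' closure
        (ball (ρ' • (EuclideanSpace.single (⟨0, by omega⟩ : Fin N) (1 : ℝ))) r \
          ball (ρ • (EuclideanSpace.single (⟨0, by omega⟩ : Fin N) (1 : ℝ))) r))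
      (r ^ 2 + ρ * ρ') := by
  set e : Euc N := EuclideanSpace.single ⟨0, by omega⟩ 1
  have he : ‖e‖ = 1 := by simp [e]
  set f : Euc N := EuclideanSpace.single ⟨1, by omega⟩ 1
  have hf : ‖f‖ = 1 := by simp [f]
  have hfe : ⟪f, e⟫ = 0 := by simp [e, f, EuclideanSpace.inner_single_left]
  obtain ⟨p, hpρ, hpρ', hp⟩ := exists_norm_sub_smul_eq he hf hfe hr.le
    (show |ρ' - ρ| ≤ 2 * r by rwa [abs_of_pos (sub_pos.2 hlt)])
  have hρ' : 0 < ρ' := hρ.trans hlt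
  have hne : ρ • e ≠ ρ' • e := fun h =>
    hlt.ne (smul_left_injective ℝ (norm_ne_zero_iff.1 (he ▸ one_ne_zero)) h)
  refine ⟨⟨⟨p, mem_closure_ball_diff_ball hne hpρ hpρ', hp⟩, ?_⟩,
    ⟨⟨p, mem_closure_ball_diff_ball hne.symm hpρ' hpρ, hp⟩, ?_⟩⟩
  · rintro _ ⟨y, hy, rfl⟩
    obtain ⟨h₁, h₂⟩ := sq_bounds_of_mem_closure_ball_diff_ball he hr.le hy
    refine le_of_mul_le_mul_left ?_ (sub_pos.2 hlt)
    dsimp only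
    linear_combination ρ' * h₁ + ρ * h₂
  · rintro _ ⟨y, hy, rfl⟩
    obtain ⟨h₁, h₂⟩ := sq_bounds_of_mem_closure_ball_diff_ball he hr.le hy
    refine le_of_mul_le_mul_left ?_ (sub_pos.2 hlt)
    dsimp only
    linear_combination ρ * h₁ + ρ' * h₂
end
end

section
/- Let N ≥ 1, r > 0, and let W : ℝ^N → [0,∞) be radially symmetric and radially nonincreasing, i.e. W(x) = w(|x|) for some nonincreasing w : [0,∞) → [0,∞), and assume ∫_{ℝ^N} W(z)·min(|z|²,1) dz < ∞. Define Φ₁(x) = ∫_{ℝ^N∖B_r} W(x−y) dy for |x| < r. Then Φ₁(x) is finite for every |x| < r, Φ₁ is radial, and Φ₁ is radially nondecreasing: whenever |x₁| ≤ |x₂| < r one has Φ₁(x₁) ≤ Φ₁(x₂). -/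
open MeasureTheory Metric

noncomputable section

theorem integrableOn_comp_sub_compl_ball {E : Type*} [NormedAddCommGroup E] [MeasurableSpace E]
    [BorelSpace E] {μ : Measure E} [μ.IsAddLeftInvariant] [μ.IsNegInvariant]
    {W : E → ℝ} (hW : Integrable (fun z => W z * min (‖z‖ ^ 2) 1) μ) {r : ℝ} {x : E}
    (hx : ‖x‖ < r) : IntegrableOn (fun y => W (x - y)) (ball (0 : E) r)ᶜ μ := by
  have hd : 0 < min ((r - ‖x‖) ^ 2) 1 := lt_min (by nlinarith) one_pos
  have hlow : ∀ y ∈ (ball (0 : E) r)ᶜ, min ((r - ‖x‖) ^ 2) 1 ≤ min (‖x - y‖ ^ 2) 1 := by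
    intro y hy
    have hy' : r ≤ ‖y‖ := by simpa using hy
    have := norm_sub_norm_le y x
    rw [norm_sub_rev] at this
    gcongr
    · linarith
  have hmeas : MeasurableSet (ball (0 : E) r)ᶜ := measurableSet_ball.compl
  have hg := (hW.comp_sub_left x).integrableOn (s := (ball (0 : E) r)ᶜ)
  have hk : Measurable fun y : E => (max (min ((r - ‖x‖) ^ 2) 1) (min (‖x - y‖ ^ 2) 1))⁻¹ := by
    have : Continuous fun y : E => max (min ((r - ‖x‖) ^ 2) 1) (min (‖x - y‖ ^ 2) 1) := by
      fun_prop
    exact this.measurable.inv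
  have hprod := hg.mul_bdd (c := (min ((r - ‖x‖) ^ 2) 1)⁻¹) hk.aestronglyMeasurable
    (Filter.Eventually.of_forall fun y => by
      rw [norm_inv, Real.norm_of_nonneg (hd.le.trans (le_max_left _ _))]
      exact inv_anti₀ hd (le_max_left _ _))
  refine IntegrableOn.congr_fun hprod (fun y hy => ?_) hmeas
  have hpos := hd.trans_le (hlow y hy)
  simp only [max_eq_right (hlow y hy)]
  field_simp

/-- The reflection in the perpendicular bisector of two points exchanges the distances to these
points. -/
theorem exists_measurePreserving_swap {E : Type*} [NormedAddCommGroup E] [InnerProductSpace ℝ E]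
    [FiniteDimensional ℝ E] [MeasurableSpace E] [BorelSpace E] (x₁ x₂ : E) :
    ∃ σ : E → E, MeasurePreserving σ ∧ MeasurableEmbedding σ ∧
      (∀ y, ‖x₂ - σ y‖ = ‖x₁ - y‖) ∧ (∀ y, ‖x₁ - σ y‖ = ‖x₂ - y‖) ∧
      ∀ y, (‖σ y‖ ^ 2 - ‖y‖ ^ 2) * ‖x₂ - x₁‖ ^ 2 =
        (‖x₂ - y‖ ^ 2 - ‖x₁ - y‖ ^ 2) * (‖x₂‖ ^ 2 - ‖x₁‖ ^ 2) := by
  set R := (ℝ ∙ (x₂ - x₁))ᗮ.reflection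
  have hRv : R (x₂ - x₁) = -(x₂ - x₁) :=
    Submodule.reflection_orthogonalComplement_singleton_eq_neg _
  refine ⟨fun y => R (y - x₁) + x₂, ?_, ?_, fun y => ?_, fun y => ?_, fun y => ?_⟩
  · exact (measurePreserving_add_right volume x₂).comp
      (R.measurePreserving.comp (measurePreserving_sub_right volume x₁))
  · exact (measurableEmbedding_addRight x₂).comp
      (R.toHomeomorph.measurableEmbedding.comp (measurableEmbedding_subRight x₁))
  · rw [show x₂ - (R (y - x₁) + x₂) = -R (y - x₁) by abel, norm_neg, R.norm_map, norm_sub_rev]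
  · rw [show x₁ - (R (y - x₁) + x₂) = -(x₂ - x₁) - R (y - x₁) by abel, ← hRv, ← map_sub,
      R.norm_map, sub_sub_sub_cancel_right]
  · rcases eq_or_ne x₁ x₂ with rfl | hne
    · simp
    have hv : ‖x₂ - x₁‖ ≠ 0 := by simpa [sub_eq_zero] using hne.symm
    obtain ⟨v, rfl⟩ : ∃ v, x₂ = x₁ + v := ⟨x₂ - x₁, by abel⟩
    obtain ⟨u, rfl⟩ : ∃ u, y = x₁ + u := ⟨y - x₁, by abel⟩
    simp only [add_sub_cancel_left, add_sub_add_left_eq_sub, sub_add_cancel_left, norm_neg] at hv ⊢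
    have hR : R u + (x₁ + v) = (x₁ + u) + (1 - 2 * (inner ℝ v u / ‖v‖ ^ 2)) • v := by
      simp only [R, add_sub_cancel_left, Submodule.reflection_orthogonal_apply,
        Submodule.reflection_singleton_apply]
      simp only [RCLike.ofReal_real_eq_id, id]
      module
    rw [hR, norm_add_sq_real (x₁ + u), norm_sub_sq_real, norm_add_sq_real x₁ v, norm_smul, mul_pow,
      Real.norm_eq_abs, sq_abs, inner_smul_right, inner_add_left, real_inner_comm v u]
    field_simp
    ring

/-- Integrals of an integrable function over a set are nonnegative as soon as the function changes
sign under a measure preserving map which sends the points of the set where the function is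
negative into the set, and the other points of the complement into the complement. -/
theorem setIntegral_nonneg_of_antisymm {α : Type*} [MeasurableSpace α] {μ : Measure α} {σ : α → α}
    (hσ : MeasurePreserving σ μ μ) (hσe : MeasurableEmbedding σ) {s : Set α}
    (hs : MeasurableSet s) {f : α → ℝ} (hf : IntegrableOn f s μ) (hanti : ∀ y, f (σ y) = -f y)
    (hneg : ∀ y, f y < 0 → y ∈ s → σ y ∈ s) (hpos : ∀ y, 0 < f y → σ y ∈ s → y ∈ s) :
    0 ≤ ∫ y in s, f y ∂μ := by
  have hi : Integrable (s.indicator f) μ := hf.integrable_indicator hs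
  have hσi : Integrable (s.indicator f ∘ σ) μ := (hσ.integrable_comp_emb hσe).2 hi
  have hsum : 0 ≤ ∫ y, (s.indicator f y + (s.indicator f ∘ σ) y) ∂μ := by
    refine integral_nonneg fun y => ?_
    by_cases hy : y ∈ s <;> by_cases hy' : σ y ∈ s <;> simp [Set.indicator, hy, hy', hanti]
    · exact not_lt.1 fun h => hy' (hneg y h hy)
    · exact not_lt.1 fun h => hy (hpos y h hy')
  rw [integral_add hi hσi] at hsum
  have heq : ∫ y, (s.indicator f ∘ σ) y ∂μ = ∫ y, s.indicator f y ∂μ :=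
    hσ.integral_comp hσe _
  rw [← integral_indicator hs]
  linarith

/-- **Monotonicity of `Φ₁`** (Proposition 2.11, first part): for a radially
symmetric, radially nonincreasing `W` with `∫ W(z)·min(|z|²,1) dz < ∞`, the
function `Φ₁(x) = ∫_{ℝ^N∖B_r} W(x-y) dy` is finite for `|x| < r`, radial, and
radially nondecreasing on `B_r`. -/
theorem Phi1_radially_nondecreasing
    {N : ℕ} (hN : 1 ≤ N) (r : ℝ) (hr : 0 < r)
    (W : Euc N → ℝ) (w : ℝ → ℝ)
    (hWrad : ∀ x, W x = w ‖x‖)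
    (hwnn : ∀ s : ℝ, 0 ≤ s → 0 ≤ w s)
    (hwanti : AntitoneOn w (Set.Ici (0 : ℝ)))
    (hWint : Integrable (fun z : Euc N => W z * min (‖z‖ ^ 2) 1)) :
    (∀ x : Euc N, ‖x‖ < r → IntegrableOn (fun y => W (x - y)) (ball (0 : Euc N) r)ᶜ) ∧
      (∀ x₁ x₂ : Euc N, ‖x₁‖ ≤ ‖x₂‖ → ‖x₂‖ < r →
        (∫ y in (ball (0 : Euc N) r)ᶜ, W (x₁ - y)) ≤
          ∫ y in (ball (0 : Euc N) r)ᶜ, W (x₂ - y)) := by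
  have hint : ∀ x : Euc N, ‖x‖ < r →
      IntegrableOn (fun y => W (x - y)) (ball (0 : Euc N) r)ᶜ :=
    fun x hx => integrableOn_comp_sub_compl_ball hWint hx
  refine ⟨hint, fun x₁ x₂ h₁₂ h₂ => ?_⟩
  have hi₁ := hint x₁ (h₁₂.trans_lt h₂)
  have hi₂ := hint x₂ h₂
  rcases eq_or_ne x₁ x₂ with rfl | hne
  · exact le_rfl
  obtain ⟨σ, hσ, hσe, hσ₂, hσ₁, hσn⟩ := exists_measurePreserving_swap x₁ x₂
  have hv : 0 < ‖x₂ - x₁‖ ^ 2 := by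
    have := norm_pos_iff.2 (sub_ne_zero.2 hne.symm)
    positivity
  have hsq : 0 ≤ ‖x₂‖ ^ 2 - ‖x₁‖ ^ 2 := sub_nonneg.2 (by gcongr)
  have hlt : ∀ a b : Euc N, W a < W b → ‖b‖ < ‖a‖ := fun a b hab => by
    by_contra! h
    rw [hWrad, hWrad] at hab
    exact hab.not_ge (hwanti (norm_nonneg a) (norm_nonneg b) h)
  rw [← sub_nonneg, ← integral_sub hi₂ hi₁]
  refine setIntegral_nonneg_of_antisymm hσ hσe measurableSet_ball.compl (hi₂.sub hi₁)
    (fun y => ?_) (fun y hy hys => ?_) (fun y hy hys => ?_)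
  · simp only [hWrad, hσ₁, hσ₂]
    ring
  · have hd : ‖x₁ - y‖ ^ 2 ≤ ‖x₂ - y‖ ^ 2 := by
      have := hlt _ _ (sub_neg.1 hy)
      gcongr
    have hn : ‖y‖ ≤ ‖σ y‖ := by
      refine (sq_le_sq₀ (norm_nonneg _) (norm_nonneg _)).1 ?_
      refine sub_nonneg.1 (nonneg_of_mul_nonneg_left ?_ hv)
      rw [hσn]
      exact mul_nonneg (sub_nonneg.2 hd) hsq
    simp only [Set.mem_compl_iff, mem_ball_zero_iff, not_lt] at hys ⊢
    exact hys.trans hn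
  · have hd : ‖x₂ - y‖ ^ 2 ≤ ‖x₁ - y‖ ^ 2 := by
      have := hlt _ _ (sub_pos.1 hy)
      gcongr
    have hn : ‖σ y‖ ≤ ‖y‖ := by
      refine (sq_le_sq₀ (norm_nonneg _) (norm_nonneg _)).1 ?_
      refine sub_nonpos.1 (nonpos_of_mul_nonpos_left ?_ hv)
      rw [hσn]
      exact mul_nonpos_of_nonpos_of_nonneg (sub_nonpos.2 hd) hsq
    simp only [Set.mem_compl_iff, mem_ball_zero_iff, not_lt] at hys ⊢
    exact hys.trans hn
end
end

section
/- Let R > 0 and let u, v be nonnegative, integrable, radially symmetric and radially nonincreasing functions on the ball B_R ⊂ ℝ^N (i.e. u(x) = ũ(|x|), v(x) = ṽ(|x|) with ũ, ṽ nonincreasing on [0,R]). Then the following are equivalent: (i) ∫_{B_r} u(x) dx ≤ ∫_{B_r} v(x) dx for every r ∈ (0,R]; (ii) for every convex, nonnegative, Lipschitz function Φ : [0,∞) → [0,∞) with Φ(0) = 0 one has ∫_{B_R} Φ(u(x)) dx ≤ ∫_{B_R} Φ(v(x)) dx. -/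
open MeasureTheory Metric

noncomputable section

theorem ConvexOn.exists_subgradient {f : ℝ → ℝ} (hf : ConvexOn ℝ Set.univ f) (x : ℝ) :
    ∃ c, ∀ y, f x + c * (y - x) ≤ f y := by
  have hx : x ∈ interior (Set.univ : Set ℝ) := by simp
  refine ⟨derivWithin f (Set.Ioi x) x, fun y => ?_⟩
  rcases lt_trichotomy x y with h | rfl | h
  · have := hf.rightDeriv_le_slope_of_mem_interior hx (Set.mem_univ y) h
    rw [slope_def_field, le_div_iff₀ (sub_pos.2 h)] at this
    linarith
  · simp
  · have := (hf.slope_le_leftDeriv_of_mem_interior (Set.mem_univ y) hx h).trans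
      (hf.leftDeriv_le_rightDeriv_of_mem_interior hx)
    rw [slope_def_field, div_le_iff₀ (sub_pos.2 h)] at this
    linarith

/-- A monotone convex Lipschitz function on `ℝ` admits a monotone, nonnegative and bounded choice of
subgradients. -/
theorem ConvexOn.exists_monotone_subgradient {f : ℝ → ℝ} {L : NNReal}
    (hf : ConvexOn ℝ Set.univ f) (hmono : Monotone f) (hL : LipschitzWith L f) :
    ∃ g : ℝ → ℝ, Monotone g ∧ (∀ x, 0 ≤ g x) ∧ (∀ x, g x ≤ L) ∧
      ∀ x y, f x + g x * (y - x) ≤ f y := by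
  choose g hg using hf.exists_subgradient
  refine ⟨g, fun x y hxy => ?_, fun x => ?_, fun x => ?_, hg⟩
  · rcases hxy.eq_or_lt with rfl | h
    · rfl
    · nlinarith [hg x y, hg y x]
  · nlinarith [hg x (x - 1), hmono (sub_le_self x zero_le_one)]
  · have := hL.dist_le_mul (x + 1) x
    rw [Real.dist_eq, Real.dist_eq, add_sub_cancel_left, abs_one, mul_one] at this
    linarith [hg x (x + 1), le_abs_self (f (x + 1) - f x)]

/-- A convex nonnegative function on `[0, ∞)` vanishing at `0` is monotone there. -/
theorem ConvexOn.monotoneOn_Ici_of_nonneg {Φ : ℝ → ℝ} (hΦ : ConvexOn ℝ (Set.Ici 0) Φ)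
    (hnn : ∀ s, 0 ≤ s → 0 ≤ Φ s) (h0 : Φ 0 = 0) : MonotoneOn Φ (Set.Ici 0) := by
  intro a ha b hb hab
  rw [Set.mem_Ici] at ha hb
  rcases hb.eq_or_lt with rfl | hb'
  · rw [le_antisymm hab ha]
  have hle : a / b ≤ 1 := (div_le_one hb').2 hab
  have key := hΦ.2 (Set.mem_Ici.2 le_rfl) (Set.mem_Ici.2 hb) (sub_nonneg.2 hle)
    (div_nonneg ha hb) (sub_add_cancel 1 (a / b))
  simp only [smul_eq_mul, mul_zero, zero_add, h0, div_mul_cancel₀ _ hb'.ne'] at key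
  exact key.trans (mul_le_of_le_one_left (hnn b hb) hle)

theorem ConvexOn.comp_max_zero {Φ : ℝ → ℝ} (hΦ : ConvexOn ℝ (Set.Ici 0) Φ)
    (hmono : MonotoneOn Φ (Set.Ici 0)) : ConvexOn ℝ Set.univ (fun s => Φ (max s 0)) := by
  have himg : (fun s : ℝ => max s 0) '' Set.univ = Set.Ici 0 := by
    ext y
    simp only [Set.image_univ, Set.mem_range, Set.mem_Ici]
    exact ⟨fun ⟨s, hs⟩ => hs ▸ le_max_right s 0, fun h => ⟨y, max_eq_left h⟩⟩
  have hmax : ConvexOn ℝ Set.univ (fun s : ℝ => max s 0) :=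
    (convexOn_id convex_univ).sup (convexOn_const 0 convex_univ)
  exact ConvexOn.comp (himg ▸ hΦ) hmax (himg ▸ hmono)

theorem LipschitzOnWith.comp_max_zero {Φ : ℝ → ℝ} {L : NNReal}
    (hΦ : LipschitzOnWith L Φ (Set.Ici 0)) : LipschitzWith L (fun s => Φ (max s 0)) := by
  refine LipschitzWith.of_dist_le_mul fun x y => ?_
  refine (hΦ.dist_le_mul _ (le_max_right x 0) _ (le_max_right y 0)).trans ?_
  gcongr
  exact abs_max_sub_max_le_abs x y 0

section Radial

variable {E : Type*} [NormedAddCommGroup E] [NormedSpace ℝ E] [FiniteDimensional ℝ E]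
  [MeasurableSpace E] [BorelSpace E] {μ : Measure E} [μ.IsAddHaarMeasure]

/-- Comparing the integrals of `(u - k)⁺` and `(v - k)⁺`, where `ball 0 r` is a superlevel set of `v`
at height `k`, compares the masses on `ball 0 r`. -/
theorem setIntegral_ball_le_of_integral_truncation_le {R r k : ℝ} (hrR : r ≤ R) {u v : E → ℝ}
    (hu : IntegrableOn u (ball 0 R) μ) (hv : IntegrableOn v (ball 0 R) μ)
    (hin : ∀ x ∈ ball (0 : E) r, k ≤ v x) (hout : ∀ x ∈ ball (0 : E) R \ ball 0 r, v x ≤ k)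
    (h : ∫ x in ball 0 R, max (u x - k) 0 ∂μ ≤ ∫ x in ball 0 R, max (v x - k) 0 ∂μ) :
    ∫ x in ball 0 r, u x ∂μ ≤ ∫ x in ball 0 r, v x ∂μ := by
  have hsub : ball (0 : E) r ⊆ ball 0 R := ball_subset_ball hrR
  have hk {s : ℝ} : IntegrableOn (fun _ : E => k) (ball 0 s) μ :=
    integrableOn_const measure_ball_lt_top.ne
  have hpos : IntegrableOn (fun x => max (u x - k) 0) (ball 0 R) μ := (hu.sub hk).pos_part
  have hv_eq : ∫ x in ball 0 R, max (v x - k) 0 ∂μ = ∫ x in ball 0 r, (v x - k) ∂μ := by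
    rw [setIntegral_eq_of_subset_of_forall_sdiff_eq_zero measurableSet_ball hsub
      fun x hx => max_eq_right (sub_nonpos.2 (hout x hx))]
    exact setIntegral_congr_fun measurableSet_ball fun x hx =>
      max_eq_left (sub_nonneg.2 (hin x hx))
  have hu_le : ∫ x in ball 0 r, (u x - k) ∂μ ≤ ∫ x in ball 0 R, max (u x - k) 0 ∂μ :=
    (setIntegral_mono_on ((hu.mono_set hsub).sub hk) (hpos.mono_set hsub) measurableSet_ball
      fun x _ => le_max_left _ _).trans
      (setIntegral_mono_set hpos (Filter.Eventually.of_forall fun x => le_max_right _ _)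
        hsub.eventuallyLE)
  rw [integral_sub (hu.mono_set hsub) hk] at hu_le
  rw [integral_sub (hv.mono_set hsub) hk] at hv_eq
  linarith

variable [Nontrivial E]

/-- A superlevel set in `ball 0 R` of a radially nonincreasing function is a.e. equal to a ball. -/
theorem exists_superlevel_ae_eq_ball {R : ℝ} (hR : 0 ≤ R) {G : ℝ → ℝ} (hG : Antitone G) (t : ℝ) :
    ∃ s ∈ Set.Icc 0 R, ({x : E | t < G ‖x‖} ∩ ball 0 R : Set E) =ᵐ[μ] ball (0 : E) s := by
  set S : Set ℝ := {r ∈ Set.Icc 0 R | t < G r} with hS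
  have hbdd : BddAbove S := ⟨R, fun r hr => hr.1.2⟩
  refine ⟨sSup S, ⟨Real.sSup_nonneg fun r hr => hr.1.1, Real.sSup_le (fun r hr => hr.1.2) hR⟩, ?_⟩
  have hlower : ball (0 : E) (sSup S) ⊆ {x : E | t < G ‖x‖} ∩ ball 0 R := by
    intro x hx
    rw [mem_ball_zero_iff] at hx
    have hne : S.Nonempty := by
      by_contra h
      rw [Set.not_nonempty_iff_eq_empty.1 h, Real.sSup_empty] at hx
      exact (norm_nonneg x).not_gt hx
    obtain ⟨r, hr, hxr⟩ := exists_lt_of_lt_csSup hne hx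
    exact ⟨hr.2.trans_le (hG hxr.le), mem_ball_zero_iff.2 (hxr.trans_le hr.1.2)⟩
  have hupper : ({x : E | t < G ‖x‖} ∩ ball 0 R : Set E) ⊆ closedBall (0 : E) (sSup S) :=
    fun x hx => mem_closedBall_zero_iff.2 <|
      le_csSup hbdd ⟨⟨norm_nonneg x, (mem_ball_zero_iff.1 hx.2).le⟩, hx.1⟩
  have hae : ball (0 : E) (sSup S) =ᵐ[μ] closedBall (0 : E) (sSup S) := by
    rw [← ball_union_sphere]
    exact (union_ae_eq_left_of_ae_eq_empty
      (ae_eq_empty.2 (Measure.addHaar_sphere μ 0 (sSup S)))).symm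
  exact (hupper.eventuallyLE.trans hae.symm.le).antisymm hlower.eventuallyLE

/-- Integrating against a bounded nonnegative radially nonincreasing weight preserves nonnegativity
of the mass on balls. -/
theorem setIntegral_ball_antitone_mul_nonneg {R L : ℝ} (hR : 0 ≤ R) {G : ℝ → ℝ} (hG : Antitone G)
    (hG0 : ∀ r, 0 ≤ G r) (hGL : ∀ r, G r ≤ L) {w : E → ℝ} (hw : IntegrableOn w (ball 0 R) μ)
    (hmass : ∀ r ∈ Set.Ioc 0 R, 0 ≤ ∫ x in ball 0 r, w x ∂μ) :
    0 ≤ ∫ x in ball 0 R, G ‖x‖ * w x ∂μ := by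
  have hGm : Measurable fun x : E => G ‖x‖ := hG.measurable.comp measurable_norm
  let F : E → ℝ → ℝ := fun x t => {p : E × ℝ | p.2 < G ‖p.1‖}.indicator (fun p => w p.1) (x, t)
  have hset : MeasurableSet {p : E × ℝ | p.2 < G ‖p.1‖} :=
    measurableSet_lt measurable_snd (hGm.comp measurable_fst)
  have hF : Integrable (Function.uncurry F)
      ((μ.restrict (ball 0 R)).prod (volume.restrict (Set.Ioc 0 L))) :=
    (Integrable.comp_fst hw (volume.restrict (Set.Ioc 0 L))).indicator hset
  have hx (x : E) : ∫ t in Set.Ioc 0 L, F x t = G ‖x‖ * w x := by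
    have : F x = (Set.Iio (G ‖x‖)).indicator fun _ => w x := by
      ext t
      simp [F, Set.indicator_apply]
    have hinter : (Set.Iio (G ‖x‖) ∩ Set.Ioc 0 L : Set ℝ) =ᵐ[volume] Set.Ioc 0 (G ‖x‖) := by
      refine Filter.EventuallyEq.trans ?_ Ioo_ae_eq_Ioc
      exact Filter.EventuallyEq.of_eq <| Set.ext fun t =>
        ⟨fun h => ⟨h.2.1, h.1⟩, fun h => ⟨h.2, h.1, h.2.le.trans (hGL _)⟩⟩
    rw [this, integral_indicator measurableSet_Iio, Measure.restrict_restrict measurableSet_Iio,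
      setIntegral_congr_set hinter, setIntegral_const, Real.volume_real_Ioc_of_le (hG0 _), sub_zero,
      smul_eq_mul]
  have ht (t : ℝ) : 0 ≤ ∫ x in ball 0 R, F x t ∂μ := by
    have hm : MeasurableSet {x : E | t < G ‖x‖} := measurableSet_lt measurable_const hGm
    have : (fun x => F x t) = {x : E | t < G ‖x‖}.indicator w := by
      ext x
      simp [F, Set.indicator_apply]
    obtain ⟨s, hs, hE⟩ := exists_superlevel_ae_eq_ball (E := E) (μ := μ) hR hG t
    rw [this, integral_indicator hm, Measure.restrict_restrict hm, setIntegral_congr_set hE]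
    rcases hs.1.eq_or_lt with rfl | h
    · simp
    · exact hmass s ⟨h, hs.2⟩
  rw [← integral_congr_ae (Filter.Eventually.of_forall hx), integral_integral_swap hF]
  exact integral_nonneg ht

/-- Comparison of the masses on balls implies comparison of convex integrals. -/
theorem integral_comp_le_of_forall_ball {R : ℝ} (hR : 0 ≤ R) {u v : E → ℝ} {ut : ℝ → ℝ}
    (hurad : ∀ x ∈ ball (0 : E) R, u x = ut ‖x‖) (hut : AntitoneOn ut (Set.Icc 0 R))
    (hu : IntegrableOn u (ball 0 R) μ) (hv : IntegrableOn v (ball 0 R) μ)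
    (h : ∀ r ∈ Set.Ioc 0 R, ∫ x in ball 0 r, u x ∂μ ≤ ∫ x in ball 0 r, v x ∂μ)
    {f : ℝ → ℝ} {L : NNReal} (hf : ConvexOn ℝ Set.univ f) (hmono : Monotone f)
    (hL : LipschitzWith L f) :
    ∫ x in ball 0 R, f (u x) ∂μ ≤ ∫ x in ball 0 R, f (v x) ∂μ := by
  obtain ⟨g, hg, hg0, hgL, hsub⟩ := hf.exists_monotone_subgradient hmono hL
  have hint {w : E → ℝ} (hw : IntegrableOn w (ball 0 R) μ) :
      IntegrableOn (fun x => f (w x)) (ball 0 R) μ := by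
    have hfin : IntegrableOn (fun _ : E => |f 0|) (ball 0 R) μ :=
      integrableOn_const measure_ball_lt_top.ne
    refine Integrable.mono' ((hw.norm.const_mul (L : ℝ)).add hfin)
      (hL.continuous.comp_aestronglyMeasurable hw.aestronglyMeasurable)
      (Filter.Eventually.of_forall fun x => ?_)
    have := hL.dist_le_mul (w x) 0
    rw [Real.dist_eq, Real.dist_eq, sub_zero] at this
    simp only [Real.norm_eq_abs, Pi.add_apply]
    linarith [abs_sub_abs_le_abs_sub (f (w x)) (f 0)]
  let G : ℝ → ℝ := fun r => g (ut (Set.projIcc 0 R hR r))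
  have hG : Antitone G := fun a b hab =>
    hg (hut (Subtype.prop _) (Subtype.prop _) (Set.monotone_projIcc hR hab))
  have hGu {x : E} (hx : x ∈ ball 0 R) : G ‖x‖ = g (u x) := by
    simp only [G]
    rw [Set.projIcc_of_mem hR ⟨norm_nonneg x, (mem_ball_zero_iff.1 hx).le⟩, hurad x hx]
  have key : 0 ≤ ∫ x in ball 0 R, G ‖x‖ * (v x - u x) ∂μ := by
    refine setIntegral_ball_antitone_mul_nonneg hR hG (fun _ => hg0 _) (fun _ => hgL _)
      (hv.sub hu) fun r hr => ?_
    have hsub : ball (0 : E) r ⊆ ball 0 R := ball_subset_ball hr.2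
    rw [integral_sub (hv.mono_set hsub) (hu.mono_set hsub)]
    exact sub_nonneg.2 (h r hr)
  have hGint : IntegrableOn (fun x => G ‖x‖ * (v x - u x)) (ball 0 R) μ := by
    refine (hv.sub hu).bdd_mul (c := L)
      (hG.measurable.comp measurable_norm).aestronglyMeasurable
      (Filter.Eventually.of_forall fun x => ?_)
    rw [Real.norm_of_nonneg (hg0 _)]
    exact hgL _
  have hle : ∫ x in ball 0 R, G ‖x‖ * (v x - u x) ∂μ ≤
      ∫ x in ball 0 R, (f (v x) - f (u x)) ∂μ := by
    refine setIntegral_mono_on hGint ((hint hv).sub (hint hu)) measurableSet_ball fun x hx => ?_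
    rw [hGu hx]
    linarith [hsub (u x) (v x)]
  rw [integral_sub (hint hv) (hint hu)] at hle
  linarith

end Radial

/-- **Equivalent formulations of mass concentration comparison** (Proposition 2.1,
items (i) and (iii)): for nonnegative, integrable, radially nonincreasing `u, v`
on `B_R`, the comparison `∫_{B_r} u ≤ ∫_{B_r} v` for all `r ∈ (0,R]` is equivalent
to `∫_{B_R} Φ(u) ≤ ∫_{B_R} Φ(v)` for all convex, nonnegative, Lipschitz
`Φ : [0,∞) → [0,∞)` with `Φ(0) = 0`. -/
theorem concentration_iff_convex_integrals
    {N : ℕ} (hN : 1 ≤ N) (R : ℝ) (hR : 0 < R)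
    (u v : Euc N → ℝ) (ut vt : ℝ → ℝ)
    (hunn : ∀ x ∈ ball (0 : Euc N) R, 0 ≤ u x)
    (hvnn : ∀ x ∈ ball (0 : Euc N) R, 0 ≤ v x)
    (hurad : ∀ x ∈ ball (0 : Euc N) R, u x = ut ‖x‖)
    (hvrad : ∀ x ∈ ball (0 : Euc N) R, v x = vt ‖x‖)
    (hut : AntitoneOn ut (Set.Icc (0 : ℝ) R))
    (hvt : AntitoneOn vt (Set.Icc (0 : ℝ) R))
    (huint : IntegrableOn u (ball (0 : Euc N) R))
    (hvint : IntegrableOn v (ball (0 : Euc N) R)) :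
    (∀ r ∈ Set.Ioc (0 : ℝ) R,
        (∫ x in ball (0 : Euc N) r, u x) ≤ ∫ x in ball (0 : Euc N) r, v x) ↔
      (∀ Φ : ℝ → ℝ, ConvexOn ℝ (Set.Ici (0 : ℝ)) Φ →
        (∀ s : ℝ, 0 ≤ s → 0 ≤ Φ s) → (∃ L : NNReal, LipschitzOnWith L Φ (Set.Ici 0)) →
        Φ 0 = 0 →
        (∫ x in ball (0 : Euc N) R, Φ (u x)) ≤ ∫ x in ball (0 : Euc N) R, Φ (v x)) := by
  have : Nonempty (Fin N) := ⟨⟨0, hN⟩⟩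
  constructor
  · rintro h Φ hΦ hnn ⟨L, hL⟩ h0
    have hmono := hΦ.monotoneOn_Ici_of_nonneg hnn h0
    have key := integral_comp_le_of_forall_ball hR.le hurad hut huint hvint h
      (hΦ.comp_max_zero hmono)
      (fun a b hab => hmono (le_max_right a 0) (le_max_right b 0) (max_le_max_right 0 hab))
      hL.comp_max_zero
    have hpos {w : Euc N → ℝ} (hw : ∀ x ∈ ball (0 : Euc N) R, 0 ≤ w x) :
        ∫ x in ball (0 : Euc N) R, Φ (max (w x) 0) = ∫ x in ball (0 : Euc N) R, Φ (w x) :=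
      setIntegral_congr_fun measurableSet_ball fun x hx => by simp only [max_eq_left (hw x hx)]
    rwa [hpos hunn, hpos hvnn] at key
  · intro h r hr
    have hrmem : r ∈ Set.Icc 0 R := ⟨hr.1.le, hr.2⟩
    refine setIntegral_ball_le_of_integral_truncation_le (k := max (vt r) 0) hr.2 huint hvint
      (fun x hx => ?_) (fun x hx => ?_)
      (h (fun s => max (s - max (vt r) 0) 0) ?_ (fun s _ => le_max_right _ _) ⟨1, ?_⟩ (by simp))
    · have hxR := ball_subset_ball hr.2 hx
      refine max_le ?_ (hvnn x hxR)
      rw [hvrad x hxR]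
      exact hvt ⟨norm_nonneg x, (mem_ball_zero_iff.1 hxR).le⟩ hrmem (mem_ball_zero_iff.1 hx).le
    · rw [hvrad x hx.1]
      refine le_max_of_le_left (hvt hrmem ⟨norm_nonneg x, (mem_ball_zero_iff.1 hx.1).le⟩ ?_)
      simpa using hx.2
    · exact ((convexOn_id (convex_Ici 0)).sub (concaveOn_const _ (convex_Ici 0))).sup
        (convexOn_const 0 (convex_Ici 0))
    · refine LipschitzOnWith.of_dist_le_mul fun x _ y _ => ?_
      rw [NNReal.coe_one, one_mul, Real.dist_eq, Real.dist_eq]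
      refine (abs_max_sub_max_le_abs _ _ 0).trans ?_
      rw [sub_sub_sub_cancel_right]
end
end

section
/- Let R > 0 and let u, v be nonnegative, integrable, radially symmetric and radially nonincreasing functions on the ball B_R ⊂ ℝ^N (i.e. u(x) = ũ(|x|), v(x) = ṽ(|x|) with ũ, ṽ nonincreasing on [0,R]). If ∫_{B_r} u(x) dx ≤ ∫_{B_r} v(x) dx for every r ∈ (0,R], then ‖u‖_{L^p(B_R)} ≤ ‖v‖_{L^p(B_R)} for every p ∈ [1,∞] (the norms being possibly infinite). -/
open MeasureTheory Metric

open scoped ENNReal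

noncomputable section

theorem lintegral_rpow_mul_ofReal_sub {p a : ℝ} (hp : 1 < p) (ha : 0 ≤ a) :
    ∫⁻ s in Set.Ioi (0 : ℝ), ENNReal.ofReal (s ^ (p - 2)) * ENNReal.ofReal (a - s) =
      ENNReal.ofReal ((p * (p - 1))⁻¹) * ENNReal.ofReal (a ^ p) := by
  have htail : ∫⁻ s in Set.Ioi a, ENNReal.ofReal (s ^ (p - 2)) * ENNReal.ofReal (a - s) = 0 := by
    refine (setLIntegral_congr_fun measurableSet_Ioi fun s hs => ?_).trans lintegral_zero
    have : a - s ≤ 0 := sub_nonpos.2 (le_of_lt hs)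
    simp [ENNReal.ofReal_of_nonpos this]
  have hint1 : IntervalIntegrable (fun s : ℝ => a * s ^ (p - 2)) volume 0 a :=
    (intervalIntegral.intervalIntegrable_rpow' (by linarith)).const_mul a
  have hint2 : IntervalIntegrable (fun s : ℝ => s ^ (p - 1)) volume 0 a :=
    intervalIntegral.intervalIntegrable_rpow' (by linarith)
  have hval : ∫ s in (0 : ℝ)..a, (a * s ^ (p - 2) - s ^ (p - 1)) = (p * (p - 1))⁻¹ * a ^ p := by
    rw [intervalIntegral.integral_sub hint1 hint2, intervalIntegral.integral_const_mul,
      integral_rpow (Or.inl (by linarith)), integral_rpow (Or.inl (by linarith)),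
      show p - 2 + 1 = p - 1 by ring, show p - 1 + 1 = p by ring,
      Real.zero_rpow (by linarith), Real.zero_rpow (by linarith), sub_zero, sub_zero]
    have h1 : a * a ^ (p - 1) = a ^ p := by
      rw [← Real.rpow_one_add' ha (by linarith)]
      ring_nf
    have h2 : p - 1 ≠ 0 := by linarith
    have h3 : p ≠ 0 := by linarith
    rw [← mul_div_assoc, h1]
    field_simp
    ring
  rw [← Set.Ioc_union_Ioi_eq_Ioi ha,
    lintegral_union measurableSet_Ioi (Set.Ioc_disjoint_Ioi le_rfl), htail, add_zero,
    ← ENNReal.ofReal_mul (inv_nonneg.2 (mul_nonneg (by linarith) (by linarith))), ← hval,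
    intervalIntegral.integral_of_le ha, ofReal_integral_eq_lintegral_ofReal]
  · refine setLIntegral_congr_fun measurableSet_Ioc fun s hs => ?_
    rw [← ENNReal.ofReal_mul (Real.rpow_nonneg hs.1.le _), mul_sub, mul_comm _ a,
      ← Real.rpow_add_one hs.1.ne', show p - 2 + 1 = p - 1 by ring]
  · exact (intervalIntegrable_iff_integrableOn_Ioc_of_le ha).1 (hint1.sub hint2)
  · filter_upwards [ae_restrict_mem measurableSet_Ioc] with s hs
    have h : s ^ (p - 1) = s * s ^ (p - 2) := by
      rw [mul_comm, ← Real.rpow_add_one hs.1.ne', show p - 2 + 1 = p - 1 by ring]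
    have := mul_le_mul_of_nonneg_right hs.2 (Real.rpow_nonneg hs.1.le (p - 2))
    simp only [Pi.zero_apply, h]
    linarith

section

variable {α : Type*} [MeasurableSpace α] {μ : Measure α}

theorem lintegral_ofReal_rpow_eq_lintegral_sub [SFinite μ] {f : α → ℝ} {p : ℝ} (hp : 1 < p)
    (hf : AEMeasurable f μ) (hf0 : 0 ≤ᵐ[μ] f) :
    ENNReal.ofReal ((p * (p - 1))⁻¹) * ∫⁻ x, ENNReal.ofReal (f x ^ p) ∂μ =
      ∫⁻ s in Set.Ioi (0 : ℝ),
        ENNReal.ofReal (s ^ (p - 2)) * ∫⁻ x, ENNReal.ofReal (f x - s) ∂μ := by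
  calc
    _ = ∫⁻ x, (∫⁻ s in Set.Ioi (0 : ℝ),
          ENNReal.ofReal (s ^ (p - 2)) * ENNReal.ofReal (f x - s)) ∂μ := by
      rw [← lintegral_const_mul' _ _ ENNReal.ofReal_ne_top]
      refine lintegral_congr_ae ?_
      filter_upwards [hf0] with x hx
      exact (lintegral_rpow_mul_ofReal_sub hp hx).symm
    _ = ∫⁻ s in Set.Ioi (0 : ℝ), ∫⁻ x,
          ENNReal.ofReal (s ^ (p - 2)) * ENNReal.ofReal (f x - s) ∂μ := by
      have h1 : AEMeasurable (fun z : α × ℝ => ENNReal.ofReal (z.2 ^ (p - 2)))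
          (μ.prod (volume.restrict (Set.Ioi 0))) := Measurable.aemeasurable (by fun_prop)
      exact lintegral_lintegral_swap
        (h1.mul (hf.comp_fst.sub measurable_snd.aemeasurable).ennreal_ofReal)
    _ = _ := by
      simp_rw [lintegral_const_mul' _ _ ENNReal.ofReal_ne_top]

/-- Two nonnegative functions `f`, `g` with `∫ (f - s)₊ ≤ ∫ (g - s)₊` for all `s ≥ 0` have
comparable `L^p` norms for every `p ≥ 1`. -/
theorem eLpNorm_le_of_lintegral_sub_le [SFinite μ] {f g : α → ℝ}
    (hf : AEMeasurable f μ) (hg : AEMeasurable g μ) (hf0 : 0 ≤ᵐ[μ] f) (hg0 : 0 ≤ᵐ[μ] g)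
    (h : ∀ s : ℝ, 0 ≤ s →
      ∫⁻ x, ENNReal.ofReal (f x - s) ∂μ ≤ ∫⁻ x, ENNReal.ofReal (g x - s) ∂μ)
    {p : ℝ≥0∞} (hp : 1 ≤ p) : eLpNorm f p μ ≤ eLpNorm g p μ := by
  have enorm_eq {w : α → ℝ} (hw : 0 ≤ᵐ[μ] w) : ∀ᵐ x ∂μ, ‖w x‖ₑ = ENNReal.ofReal (w x) :=
    hw.mono fun x hx => Real.enorm_eq_ofReal hx
  rcases eq_or_ne p ∞ with rfl | hptop
  · simp only [eLpNorm_exponent_top]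
    rcases eq_or_ne (eLpNormEssSup g μ) ∞ with htop | htop
    · simp [htop]
    have hgs : ∫⁻ x, ENNReal.ofReal (g x - (eLpNormEssSup g μ).toReal) ∂μ = 0 := by
      refine (lintegral_congr_ae ?_).trans lintegral_zero
      filter_upwards [enorm_ae_le_eLpNormEssSup g μ, enorm_eq hg0] with x hx hx'
      rw [hx', ENNReal.ofReal_le_iff_le_toReal htop] at hx
      exact ENNReal.ofReal_of_nonpos (sub_nonpos.2 hx)
    have hfs := le_antisymm ((h _ ENNReal.toReal_nonneg).trans hgs.le) zero_le
    rw [lintegral_eq_zero_iff' (hf.sub_const _).ennreal_ofReal] at hfs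
    refine eLpNormEssSup_le_of_ae_enorm_bound ?_
    filter_upwards [hfs, enorm_eq hf0] with x hx hx'
    rw [hx', ENNReal.ofReal_le_iff_le_toReal htop]
    exact sub_nonpos.1 (ENNReal.ofReal_eq_zero.1 hx)
  rcases hp.eq_or_lt with rfl | hp1
  · rw [eLpNorm_one_eq_lintegral_enorm, eLpNorm_one_eq_lintegral_enorm,
      lintegral_congr_ae (enorm_eq hf0), lintegral_congr_ae (enorm_eq hg0)]
    simpa using h 0 le_rfl
  have hq : 1 < p.toReal := by
    simpa using (ENNReal.toReal_lt_toReal ENNReal.one_ne_top hptop).2 hp1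
  have rpow_eq {w : α → ℝ} (hw : 0 ≤ᵐ[μ] w) :
      ∫⁻ x, ‖w x‖ₑ ^ p.toReal ∂μ = ∫⁻ x, ENNReal.ofReal (w x ^ p.toReal) ∂μ := by
    refine lintegral_congr_ae ?_
    filter_upwards [hw] with x hx
    rw [Real.enorm_eq_ofReal hx, ENNReal.ofReal_rpow_of_nonneg hx (by linarith)]
  have hp0 : p ≠ 0 := (zero_lt_one.trans hp1).ne'
  rw [eLpNorm_eq_lintegral_rpow_enorm_toReal hp0 hptop,
    eLpNorm_eq_lintegral_rpow_enorm_toReal hp0 hptop, rpow_eq hf0, rpow_eq hg0]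
  refine ENNReal.rpow_le_rpow ?_ (by positivity)
  have hc : ENNReal.ofReal ((p.toReal * (p.toReal - 1))⁻¹) ≠ 0 :=
    (ENNReal.ofReal_pos.2 (inv_pos.2 (mul_pos (by linarith) (by linarith)))).ne'
  rw [← ENNReal.mul_le_mul_iff_right hc ENNReal.ofReal_ne_top,
    lintegral_ofReal_rpow_eq_lintegral_sub hq hf hf0,
    lintegral_ofReal_rpow_eq_lintegral_sub hq hg hg0]
  refine setLIntegral_mono' measurableSet_Ioi fun s hs => ?_
  exact mul_le_mul_right (h s (le_of_lt hs)) _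

theorem ofReal_integral_le_lintegral_ofReal {f : α → ℝ} (hf : Integrable f μ) :
    ENNReal.ofReal (∫ x, f x ∂μ) ≤ ∫⁻ x, ENNReal.ofReal (f x) ∂μ := by
  rw [integral_eq_lintegral_pos_part_sub_lintegral_neg_part hf]
  exact (ENNReal.ofReal_le_ofReal (sub_le_self _ ENNReal.toReal_nonneg)).trans
    ENNReal.ofReal_toReal_le

end

theorem AntitoneOn.exists_superlevel_radius {f : ℝ → ℝ} {R : ℝ} (hR : 0 ≤ R)
    (hf : AntitoneOn f (Set.Icc 0 R)) (s : ℝ) :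
    ∃ r ∈ Set.Icc (0 : ℝ) R, (∀ t, 0 ≤ t → t < r → s < f t) ∧
      ∀ t, r < t → t < R → f t ≤ s := by
  let A : Set ℝ := {t ∈ Set.Icc (0 : ℝ) R | s < f t}
  have hbdd : BddAbove A := ⟨R, fun t ht => ht.1.2⟩
  have hr0 : 0 ≤ sSup A := Real.sSup_nonneg fun t ht => ht.1.1
  refine ⟨sSup A, ⟨hr0, Real.sSup_le (fun t ht => ht.1.2) hR⟩, fun t ht htr => ?_,
    fun t hrt htR => ?_⟩
  · have hne : A.Nonempty := by
      by_contra hA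
      rw [Set.not_nonempty_iff_eq_empty.1 hA, Real.sSup_empty] at htr
      exact absurd ht htr.not_ge
    obtain ⟨t', ht', htt'⟩ := exists_lt_of_lt_csSup hne htr
    exact ht'.2.trans_le (hf ⟨ht, htt'.le.trans ht'.1.2⟩ ht'.1 htt'.le)
  · by_contra! hs
    exact hrt.not_ge (le_csSup hbdd ⟨⟨hr0.trans hrt.le, htR.le⟩, hs⟩)

/-- The concentration comparison passes to the truncations `(u - s)₊` and `(v - s)₊`. -/
theorem lintegral_sub_le_of_concentration {E : Type*} [NormedAddCommGroup E] [NormedSpace ℝ E]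
    [FiniteDimensional ℝ E] [Nontrivial E] [MeasurableSpace E] [BorelSpace E] (μ : Measure E)
    [μ.IsAddHaarMeasure] {R : ℝ} (hR : 0 ≤ R) {u v : E → ℝ} {ut : ℝ → ℝ}
    (hurad : ∀ x ∈ ball (0 : E) R, u x = ut ‖x‖) (hut : AntitoneOn ut (Set.Icc (0 : ℝ) R))
    (huint : IntegrableOn u (ball (0 : E) R) μ) (hvint : IntegrableOn v (ball (0 : E) R) μ)
    (hconc : ∀ r ∈ Set.Ioc (0 : ℝ) R,
      (∫ x in ball (0 : E) r, u x ∂μ) ≤ ∫ x in ball (0 : E) r, v x ∂μ) (s : ℝ) :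
    ∫⁻ x in ball (0 : E) R, ENNReal.ofReal (u x - s) ∂μ ≤
      ∫⁻ x in ball (0 : E) R, ENNReal.ofReal (v x - s) ∂μ := by
  obtain ⟨r, ⟨hr0, hrR⟩, hin, hout⟩ := hut.exists_superlevel_radius hR s
  have hsub : ball (0 : E) r ⊆ ball 0 R := ball_subset_ball hrR
  have hs : IntegrableOn (fun _ : E => s) (ball 0 r) μ :=
    integrableOn_const measure_ball_lt_top.ne
  have hu : IntegrableOn u (ball 0 r) μ := huint.mono_set hsub
  have hv : IntegrableOn v (ball 0 r) μ := hvint.mono_set hsub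
  have hconc' : (∫ x in ball (0 : E) r, u x ∂μ) ≤ ∫ x in ball (0 : E) r, v x ∂μ := by
    rcases hr0.eq_or_lt with rfl | hr
    · simp
    · exact hconc r ⟨hr, hrR⟩
  calc
    _ = ∫⁻ x in ball (0 : E) r, ENNReal.ofReal (u x - s) ∂μ := by
      rw [← lintegral_indicator measurableSet_ball, ← lintegral_indicator measurableSet_ball]
      refine lintegral_congr_ae ?_
      filter_upwards [compl_mem_ae_iff.2 (Measure.addHaar_sphere μ (0 : E) r)] with x hx
      by_cases hxr : x ∈ ball (0 : E) r
      · rw [Set.indicator_of_mem hxr, Set.indicator_of_mem (hsub hxr)]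
      rw [Set.indicator_of_notMem hxr, Set.indicator_apply_eq_zero]
      intro hxR
      have hlt : r < ‖x‖ := lt_of_le_of_ne (by simpa using hxr) (by simpa [eq_comm] using hx)
      rw [hurad x hxR, ENNReal.ofReal_eq_zero]
      exact sub_nonpos.2 (hout _ hlt (by simpa using hxR))
    _ = ENNReal.ofReal (∫ x in ball (0 : E) r, (u x - s) ∂μ) := by
      refine (ofReal_integral_eq_lintegral_ofReal (hu.sub hs) ?_).symm
      filter_upwards [ae_restrict_mem measurableSet_ball] with x hx
      rw [Pi.zero_apply, Pi.sub_apply, hurad x (hsub hx)]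
      exact (sub_pos.2 (hin _ (norm_nonneg x) (by simpa using hx))).le
    _ ≤ ENNReal.ofReal (∫ x in ball (0 : E) r, (v x - s) ∂μ) := by
      rw [integral_sub hu hs, integral_sub hv hs]
      gcongr
    _ ≤ ∫⁻ x in ball (0 : E) r, ENNReal.ofReal (v x - s) ∂μ :=
      ofReal_integral_le_lintegral_ofReal (hv.sub hs)
    _ ≤ _ := lintegral_mono_set hsub

/-- **Lp comparison from concentration comparison** (consequence of
Proposition 2.1): for nonnegative, integrable, radially nonincreasing `u, v` on
`B_R`, if `∫_{B_r} u ≤ ∫_{B_r} v` for all `r ∈ (0,R]`, then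
`‖u‖_{L^p(B_R)} ≤ ‖v‖_{L^p(B_R)}` for all `1 ≤ p ≤ ∞`. -/
theorem Lp_norm_comparison_of_concentration
    {N : ℕ} (hN : 1 ≤ N) (R : ℝ) (hR : 0 < R)
    (u v : Euc N → ℝ) (ut vt : ℝ → ℝ)
    (hunn : ∀ x ∈ ball (0 : Euc N) R, 0 ≤ u x)
    (hvnn : ∀ x ∈ ball (0 : Euc N) R, 0 ≤ v x)
    (hurad : ∀ x ∈ ball (0 : Euc N) R, u x = ut ‖x‖)
    (hvrad : ∀ x ∈ ball (0 : Euc N) R, v x = vt ‖x‖)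
    (hut : AntitoneOn ut (Set.Icc (0 : ℝ) R))
    (hvt : AntitoneOn vt (Set.Icc (0 : ℝ) R))
    (huint : IntegrableOn u (ball (0 : Euc N) R))
    (hvint : IntegrableOn v (ball (0 : Euc N) R))
    (hconc : ∀ r ∈ Set.Ioc (0 : ℝ) R,
      (∫ x in ball (0 : Euc N) r, u x) ≤ ∫ x in ball (0 : Euc N) r, v x) :
    ∀ p : ℝ≥0∞, 1 ≤ p →
      eLpNorm u p (volume.restrict (ball (0 : Euc N) R)) ≤
        eLpNorm v p (volume.restrict (ball (0 : Euc N) R)) := by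
  intro p hp
  have : Nonempty (Fin N) := ⟨⟨0, hN⟩⟩
  refine eLpNorm_le_of_lintegral_sub_le huint.aemeasurable hvint.aemeasurable
    ?_ ?_ (fun s _ => lintegral_sub_le_of_concentration volume hR.le hurad hut huint hvint hconc s)
    hp
  · filter_upwards [ae_restrict_mem measurableSet_ball] with x hx using hunn x hx
  · filter_upwards [ae_restrict_mem measurableSet_ball] with x hx using hvnn x hx
end
end
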